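/- arXiv:0709.2215 — 2 statements merged into one kernel-verified Lean document; each statement's English description precedes it below -/
import Mathlib

section
/- Let x, y : ℝ → S³ ⊂ ℝ⁴ be C¹ curves with x(s) ≠ y(t) for all s, t. Then the signed area density is exact in the t-variable: for every (s,t), A(s,t) = ∂/∂t [ (x'(s)·y(t)) / (x(s)·y(t) − 1) ]. -/
open Matrix

/-- Dotting a differentiable curve with a constant vector commutes with differentiation. -/
theorem HasDerivAt.const_dotProduct {ι : Type*} [Fintype ι] {y : ℝ → ι → ℝ} {y' : ι → ℝ} {t : ℝ}
    (v : ι → ℝ) (hy : HasDerivAt y y' t) :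
    HasDerivAt (fun t' => v ⬝ᵥ y t') (v ⬝ᵥ y') t :=
  HasDerivAt.fun_sum fun i _ => (hasDerivAt_pi.1 hy i).const_mul (v i)

/-- Distinct unit vectors have dot product different from `1`. -/
theorem dotProduct_ne_one_of_ne {ι : Type*} [Fintype ι] {u v : ι → ℝ}
    (hu : u ⬝ᵥ u = 1) (hv : v ⬝ᵥ v = 1) (huv : u ≠ v) : u ⬝ᵥ v ≠ 1 := by
  intro h
  refine huv (sub_eq_zero.1 (dotProduct_self_eq_zero.1 ?_))
  rw [sub_dotProduct, dotProduct_sub, dotProduct_sub, dotProduct_comm v u, hu, hv, h]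
  norm_num

/-- The signed area density of the product torus is exact in the `t`-variable:
`A(s,t) = ∂/∂t [ (x'(s)·y(t)) / (x(s)·y(t) − 1) ]`. -/
theorem signed_area_density_exact_in_t
    (x y : ℝ → (Fin 4 → ℝ))
    (hx : ContDiff ℝ 1 x) (hy : ContDiff ℝ 1 y)
    (hxS : ∀ s, x s ⬝ᵥ x s = 1) (hyS : ∀ t, y t ⬝ᵥ y t = 1)
    (hdisj : ∀ s t, x s ≠ y t) :
    ∀ s t : ℝ,
      ((deriv x s ⬝ᵥ deriv y t) * (x s ⬝ᵥ y t - 1)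
        - (deriv x s ⬝ᵥ y t) * (x s ⬝ᵥ deriv y t)) / (x s ⬝ᵥ y t - 1) ^ 2
      = deriv (fun t' => (deriv x s ⬝ᵥ y t') / (x s ⬝ᵥ y t' - 1)) t := by
  intro s t
  have hyt : HasDerivAt y (deriv y t) t := (hy.differentiable one_ne_zero t).hasDerivAt
  have hne : x s ⬝ᵥ y t - 1 ≠ 0 :=
    sub_ne_zero.2 (dotProduct_ne_one_of_ne (hxS s) (hyS t) (hdisj s t))
  exact ((hyt.const_dotProduct (deriv x s)).fun_div
    ((hyt.const_dotProduct (x s)).sub_const 1) hne).deriv.symm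
end

section
/- Let x, y : ℝ → S³ ⊂ ℝ⁴ be C¹ curves with x(s) ≠ y(t) for all s, t, and let σ(s,t) = P(x̄(s), ȳ(t)) / (1 − x(s)·y(t)) ∈ ℝ¹⁰. At every (s,t), the Gram matrix of the pair (∂σ/∂s, ∂σ/∂t) with respect to Q equals [[0, A(s,t)], [A(s,t), 0]]. In particular, it is nondegenerate of signature (1,1) (index 1) if and only if A(s,t) ≠ 0, equivalently (x'(s)·y'(t))(x(s)·y(t) − 1) ≠ (x'(s)·y(t))(x(s)·y'(t)); otherwise it is degenerate. -/
open Matrix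

/-- Index set for the 10 Plücker coordinates: pairs `0 ≤ i < j ≤ 4`. -/
abbrev PIdx : Type := {p : Fin 5 × Fin 5 // p.1 < p.2}

/-- The Plücker vector of a pair of vectors in ℝ⁵. -/
noncomputable def Pl (u v : Fin 5 → ℝ) : PIdx → ℝ :=
  fun I => u I.1.1 * v I.1.2 - u I.1.2 * v I.1.1

/-- The indefinite inner product of signature (4,6) on `Λ²ℝ⁵₁ ≅ ℝ¹⁰`. -/
noncomputable def Q (z w : PIdx → ℝ) : ℝ :=
  ∑ I : PIdx, (if I.1.1 = 0 then (1:ℝ) else -1) * z I * w I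

/-- The lightlike lift `x̄ = (1, x) ∈ ℝ⁵` of a point of `S³ ⊂ ℝ⁴`. -/
noncomputable def lift (x : Fin 4 → ℝ) : Fin 5 → ℝ := Fin.cons 1 x

/-- The Minkowski product on ℝ⁵. -/
noncomputable def lorentz (u v : Fin 5 → ℝ) : ℝ :=
  vecTail u ⬝ᵥ vecTail v - u 0 * v 0

theorem Q_comm (z w : PIdx → ℝ) : Q z w = Q w z :=
  Finset.sum_congr rfl fun _ _ => by ring

theorem Q_add_left (z z' w : PIdx → ℝ) : Q (z + z') w = Q z w + Q z' w := by
  simp only [Q, ← Finset.sum_add_distrib, Pi.add_apply]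
  exact Finset.sum_congr rfl fun _ _ => by ring

theorem Q_smul_left (c : ℝ) (z w : PIdx → ℝ) : Q (c • z) w = c * Q z w := by
  simp only [Q, Finset.mul_sum, Pi.smul_apply, smul_eq_mul]
  exact Finset.sum_congr rfl fun _ _ => by ring

theorem Q_add_right (z w w' : PIdx → ℝ) : Q z (w + w') = Q z w + Q z w' := by
  rw [Q_comm, Q_add_left, Q_comm w, Q_comm w']

theorem Q_smul_right (c : ℝ) (z w : PIdx → ℝ) : Q z (c • w) = c * Q z w := by
  rw [Q_comm, Q_smul_left, Q_comm w]

/-- The Lagrange identity for the Minkowski product. -/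
theorem Q_Pl (u v u' v' : Fin 5 → ℝ) :
    Q (Pl u v) (Pl u' v') = lorentz u v' * lorentz v u' - lorentz u u' * lorentz v v' := by
  have sum_eq (f : Fin 5 × Fin 5 → ℝ) :
      ∑ I : PIdx, f I.1 = ∑ i, ∑ j, if i < j then f (i, j) else 0 := by
    rw [← Fintype.sum_prod_type' (fun i j => if i < j then f (i, j) else 0),
      ← Finset.sum_filter]
    exact (Finset.sum_subtype _ (by simp) _).symm
  have h := sum_eq fun p => (if p.1 = 0 then (1 : ℝ) else -1) *
    (u p.1 * v p.2 - u p.2 * v p.1) * (u' p.1 * v' p.2 - u' p.2 * v' p.1)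
  refine h.trans ?_
  simp [Fin.sum_univ_succ, lorentz, dotProduct, vecTail]
  ring

theorem Pl_swap (u v : Fin 5 → ℝ) : Pl v u = (-1 : ℝ) • Pl u v := by
  ext I
  simp only [Pl, Pi.smul_apply, smul_eq_mul]
  ring

theorem lorentz_lift_lift (a b : Fin 4 → ℝ) : lorentz (lift a) (lift b) = a ⬝ᵥ b - 1 := by
  simp [lorentz, lift, vecTail, Function.comp_def]

theorem lorentz_lift_cons_zero (a b : Fin 4 → ℝ) :
    lorentz (lift a) (Fin.cons 0 b) = a ⬝ᵥ b := by
  simp [lorentz, lift, vecTail, Function.comp_def]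

theorem lorentz_cons_zero_lift (a b : Fin 4 → ℝ) :
    lorentz (Fin.cons 0 a) (lift b) = a ⬝ᵥ b := by
  simp [lorentz, lift, vecTail, Function.comp_def]

theorem lorentz_cons_zero_cons_zero (a b : Fin 4 → ℝ) :
    lorentz (Fin.cons 0 a) (Fin.cons 0 b) = a ⬝ᵥ b := by
  simp [lorentz, vecTail, Function.comp_def]

theorem HasDerivAt.dotProduct_const {x : ℝ → Fin 4 → ℝ} {x' : Fin 4 → ℝ} {s : ℝ}
    (hx : HasDerivAt x x' s) (b : Fin 4 → ℝ) :
    HasDerivAt (fun a => x a ⬝ᵥ b) (x' ⬝ᵥ b) s :=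
  HasDerivAt.fun_sum fun i _ => (hasDerivAt_pi.1 hx i).mul_const (b i)

theorem dotProduct_deriv_eq_zero {x : ℝ → Fin 4 → ℝ} {x' : Fin 4 → ℝ} {s : ℝ}
    (hx : HasDerivAt x x' s) (hxS : ∀ s, x s ⬝ᵥ x s = 1) : x s ⬝ᵥ x' = 0 := by
  have h : HasDerivAt (fun a => x a ⬝ᵥ x a) (∑ i, (x' i * x s i + x s i * x' i)) s :=
    HasDerivAt.fun_sum fun i _ => (hasDerivAt_pi.1 hx i).mul (hasDerivAt_pi.1 hx i)
  simp only [hxS] at h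
  have h0 := h.unique (hasDerivAt_const s (1 : ℝ))
  rw [Finset.sum_add_distrib] at h0
  change x' ⬝ᵥ x s + x s ⬝ᵥ x' = 0 at h0
  rw [dotProduct_comm x'] at h0
  linarith

theorem HasDerivAt.lift {x : ℝ → Fin 4 → ℝ} {x' : Fin 4 → ℝ} {s : ℝ}
    (hx : HasDerivAt x x' s) :
    HasDerivAt (fun a => _root_.lift (x a)) (Fin.cons 0 x') s := by
  refine hasDerivAt_pi.2 fun i => ?_
  refine Fin.cases ?_ (fun j => ?_) i
  · simpa [_root_.lift] using hasDerivAt_const s (1 : ℝ)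
  · simpa [_root_.lift] using hasDerivAt_pi.1 hx j

theorem HasDerivAt.Pl_const {u : ℝ → Fin 5 → ℝ} {u' : Fin 5 → ℝ} {s : ℝ}
    (hu : HasDerivAt u u' s) (v : Fin 5 → ℝ) :
    HasDerivAt (fun a => Pl (u a) v) (Pl u' v) s :=
  hasDerivAt_pi.2 fun I =>
    ((hasDerivAt_pi.1 hu I.1.1).mul_const _).sub ((hasDerivAt_pi.1 hu I.1.2).mul_const _)

/-- The velocity of the normalized Plücker vector when its first point moves. -/
theorem hasDerivAt_normalized_Pl {x : ℝ → Fin 4 → ℝ} {x' : Fin 4 → ℝ} {s : ℝ}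
    (hx : HasDerivAt x x' s) (b : Fin 4 → ℝ) (hne : 1 - x s ⬝ᵥ b ≠ 0) :
    HasDerivAt (fun a => (1 - x a ⬝ᵥ b)⁻¹ • Pl (lift (x a)) (lift b))
      ((1 - x s ⬝ᵥ b)⁻¹ • Pl (Fin.cons 0 x') (lift b) +
        (x' ⬝ᵥ b / (1 - x s ⬝ᵥ b) ^ 2) • Pl (lift (x s)) (lift b)) s := by
  have h := (((hx.dotProduct_const b).const_sub 1).fun_inv hne).fun_smul (hx.lift.Pl_const (lift b))
  simpa only [neg_neg] using h

theorem dotProduct_ne_one {a b : Fin 4 → ℝ} (ha : a ⬝ᵥ a = 1) (hb : b ⬝ᵥ b = 1)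
    (hab : a ≠ b) : a ⬝ᵥ b ≠ 1 := by
  intro h
  refine hab (sub_eq_zero.1 (dotProduct_self_eq_zero.1 ?_))
  rw [sub_dotProduct, dotProduct_sub, dotProduct_sub, dotProduct_comm b a, ha, hb, h]
  norm_num

/-- the Gram matrix of `(σ_s, σ_t)` with respect to `Q` is
`[[0, A(s,t)], [A(s,t), 0]]`, where `A` is the signed area density; in particular it is
nondegenerate (of signature (1,1), index 1) iff `A(s,t) ≠ 0`, i.e. iff
`(x'·y')(x·y−1) ≠ (x'·y)(x·y')`, and degenerate otherwise. -/
theorem gram_matrix_of_product_torus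
    (x y : ℝ → (Fin 4 → ℝ))
    (hx : ContDiff ℝ 1 x) (hy : ContDiff ℝ 1 y)
    (hxS : ∀ s, x s ⬝ᵥ x s = 1) (hyS : ∀ t, y t ⬝ᵥ y t = 1)
    (hdisj : ∀ s t, x s ≠ y t)
    (σ : ℝ → ℝ → (PIdx → ℝ))
    (hσ : ∀ s t, σ s t = (1 - x s ⬝ᵥ y t)⁻¹ • Pl (lift (x s)) (lift (y t)))
    (A : ℝ → ℝ → ℝ)
    (hA : ∀ s t, A s t =
      ((deriv x s ⬝ᵥ deriv y t) * (x s ⬝ᵥ y t - 1)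
        - (deriv x s ⬝ᵥ y t) * (x s ⬝ᵥ deriv y t)) / (x s ⬝ᵥ y t - 1) ^ 2) :
    ∀ s t : ℝ,
      (!![Q (deriv (fun a => σ a t) s) (deriv (fun a => σ a t) s),
          Q (deriv (fun a => σ a t) s) (deriv (fun b => σ s b) t);
          Q (deriv (fun b => σ s b) t) (deriv (fun a => σ a t) s),
          Q (deriv (fun b => σ s b) t) (deriv (fun b => σ s b) t)]
        = !![0, A s t; A s t, 0]) ∧
      (A s t ≠ 0 ↔
        (deriv x s ⬝ᵥ deriv y t) * (x s ⬝ᵥ y t - 1)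
          ≠ (deriv x s ⬝ᵥ y t) * (x s ⬝ᵥ deriv y t)) := by
  intro s t
  have hdx : HasDerivAt x (deriv x s) s := (hx.differentiable one_ne_zero s).hasDerivAt
  have hdy : HasDerivAt y (deriv y t) t := (hy.differentiable one_ne_zero t).hasDerivAt
  have hx0 := dotProduct_deriv_eq_zero hdx hxS
  have hy0 := dotProduct_deriv_eq_zero hdy hyS
  have hne : x s ⬝ᵥ y t ≠ 1 := dotProduct_ne_one (hxS s) (hyS t) (hdisj s t)
  have hne' : 1 - x s ⬝ᵥ y t ≠ 0 := sub_ne_zero.2 hne.symm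
  have hne'' : x s ⬝ᵥ y t - 1 ≠ 0 := sub_ne_zero.2 hne
  have hσs : deriv (fun a => σ a t) s =
      (1 - x s ⬝ᵥ y t)⁻¹ • Pl (Fin.cons 0 (deriv x s)) (lift (y t)) +
        (deriv x s ⬝ᵥ y t / (1 - x s ⬝ᵥ y t) ^ 2) • Pl (lift (x s)) (lift (y t)) := by
    simp only [hσ]
    exact (hasDerivAt_normalized_Pl hdx (y t) hne').deriv
  have hσt : deriv (fun b => σ s b) t =
      (-1 : ℝ) • ((1 - x s ⬝ᵥ y t)⁻¹ • Pl (Fin.cons 0 (deriv y t)) (lift (x s)) +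
        (x s ⬝ᵥ deriv y t / (1 - x s ⬝ᵥ y t) ^ 2) • Pl (lift (y t)) (lift (x s))) := by
    have h := (hasDerivAt_normalized_Pl hdy (x s) (by rwa [dotProduct_comm])).const_smul (-1 : ℝ)
    rw [dotProduct_comm (y t), dotProduct_comm (deriv y t)] at h
    rw [← h.deriv]
    congr 1
    ext1 b
    rw [hσ, Pi.smul_apply, Pl_swap (lift (y b)), dotProduct_comm (y b), smul_comm]
  have hss : Q (deriv (fun a => σ a t) s) (deriv (fun a => σ a t) s) = 0 := by
    rw [hσs]
    simp only [Q_add_left, Q_add_right, Q_smul_left, Q_smul_right, Q_Pl, lorentz_lift_lift,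
      lorentz_lift_cons_zero, lorentz_cons_zero_lift, lorentz_cons_zero_cons_zero, hxS, hyS, hx0,
      dotProduct_comm (y t), dotProduct_comm (deriv x s) (x s)]
    field_simp
    ring
  have htt : Q (deriv (fun b => σ s b) t) (deriv (fun b => σ s b) t) = 0 := by
    rw [hσt]
    simp only [Q_add_left, Q_add_right, Q_smul_left, Q_smul_right, Q_Pl, lorentz_lift_lift,
      lorentz_lift_cons_zero, lorentz_cons_zero_lift, lorentz_cons_zero_cons_zero, hxS, hyS, hy0,
      dotProduct_comm (y t) (x s), dotProduct_comm (deriv y t)]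
    field_simp
    ring
  have hst : Q (deriv (fun a => σ a t) s) (deriv (fun b => σ s b) t) = A s t := by
    rw [hσs, hσt, hA]
    simp only [Q_add_left, Q_add_right, Q_smul_left, Q_smul_right, Q_Pl, lorentz_lift_lift,
      lorentz_lift_cons_zero, lorentz_cons_zero_lift, lorentz_cons_zero_cons_zero, hxS, hyS, hx0,
      hy0, dotProduct_comm (y t) (x s), dotProduct_comm (deriv x s) (x s)]
    rw [show (x s ⬝ᵥ y t - 1) ^ 2 = (1 - x s ⬝ᵥ y t) ^ 2 by ring]
    field_simp
    ring
  refine ⟨by rw [hss, htt, Q_comm (deriv (fun b => σ s b) t), hst], ?_⟩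
  rw [hA, div_ne_zero_iff, sub_ne_zero]
  exact and_iff_left (pow_ne_zero 2 hne'')
end
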